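/- arXiv:1812.09514 — 6 statements merged into one kernel-verified Lean document; each statement's English description precedes it below -/
import Mathlib

section
/- (Deterministic form of the BLUE property of Ȳ₁ − Ȳ₂.) Let K, n₁, n₂ ≥ 1 be integers and σ₁, σ₂ > 0, u, v > 0 reals. For all real coefficients c_{ik} (1 ≤ i ≤ n₁, 1 ≤ k ≤ K) and d_{jk} (1 ≤ j ≤ n₂, 1 ≤ k ≤ K) with Σ_{i,k} c_{ik} = 1 and Σ_{j,k} d_{jk} = 1, one has σ₁²( u·Σ_i (Σ_k c_{ik})² + Σ_{i,k} c_{ik}² ) + σ₂²( v·Σ_j (Σ_k d_{jk})² + Σ_{j,k} d_{jk}² ) ≥ σ₁²(Ku+1)/(Kn₁) + σ₂²(Kv+1)/(Kn₂), with equality if and only if c_{ik} = 1/(Kn₁) for all i,k and d_{jk} = 1/(Kn₂) for all j,k. -/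
/-- A family of reals with sum `1` over a nonempty finite type: its sum of squares exceeds that of
the uniform weights by the sum of squared deviations from them. -/
lemma sum_sq_eq_inv_card_add_sum_sq_sub {ι : Type*} [Fintype ι] [Nonempty ι] (f : ι → ℝ)
    (hf : ∑ i, f i = 1) :
    ∑ i, f i ^ 2
      = 1 / (Fintype.card ι : ℝ) + ∑ i, (f i - 1 / (Fintype.card ι : ℝ)) ^ 2 := by
  have hN : (Fintype.card ι : ℝ) ≠ 0 := Nat.cast_ne_zero.mpr Fintype.card_ne_zero
  simp only [sub_sq, Finset.sum_add_distrib, Finset.sum_sub_distrib, ← Finset.sum_mul,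
    ← Finset.mul_sum, hf, Finset.sum_const, Finset.card_univ, nsmul_eq_mul]
  field_simp
  ring

/-- The variance factor of a one-group linear unbiased estimator, as its minimum plus squares. -/
lemma group_variance_eq_min_add {ι κ : Type*} [Fintype ι] [Fintype κ] [Nonempty ι] [Nonempty κ]
    (u : ℝ) (c : ι → κ → ℝ) (hc : ∑ i, ∑ k, c i k = 1) :
    u * ∑ i, (∑ k, c i k) ^ 2 + ∑ i, ∑ k, c i k ^ 2
      = ((Fintype.card κ : ℝ) * u + 1) / ((Fintype.card κ : ℝ) * (Fintype.card ι : ℝ))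
        + (u * ∑ i, (∑ k, c i k - 1 / (Fintype.card ι : ℝ)) ^ 2
          + ∑ i, ∑ k, (c i k - 1 / ((Fintype.card κ : ℝ) * (Fintype.card ι : ℝ))) ^ 2) := by
  have hι : (Fintype.card ι : ℝ) ≠ 0 := Nat.cast_ne_zero.mpr Fintype.card_ne_zero
  have hκ : (Fintype.card κ : ℝ) ≠ 0 := Nat.cast_ne_zero.mpr Fintype.card_ne_zero
  have hrow := sum_sq_eq_inv_card_add_sum_sq_sub (fun i => ∑ k, c i k) hc
  have hall := sum_sq_eq_inv_card_add_sum_sq_sub (fun p : ι × κ => c p.1 p.2)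
    (by rw [Fintype.sum_prod_type]; exact hc)
  simp only [Fintype.sum_prod_type, Fintype.card_prod, Nat.cast_mul,
    mul_comm (Fintype.card ι : ℝ)] at hall
  rw [hrow, hall]
  field_simp
  ring

/-- Minimality of the one-group variance factor, with the uniform weights as unique minimizer. -/
lemma group_variance_min {K n : ℕ} (hK : 1 ≤ K) (hn : 1 ≤ n) {u : ℝ} (hu : 0 < u)
    (c : Fin n → Fin K → ℝ) (hc : ∑ i, ∑ k, c i k = 1) :
    ((K : ℝ) * u + 1) / ((K : ℝ) * (n : ℝ))
        ≤ u * ∑ i, (∑ k, c i k) ^ 2 + ∑ i, ∑ k, c i k ^ 2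
      ∧ (((K : ℝ) * u + 1) / ((K : ℝ) * (n : ℝ))
          = u * ∑ i, (∑ k, c i k) ^ 2 + ∑ i, ∑ k, c i k ^ 2
        ↔ ∀ i k, c i k = 1 / ((K : ℝ) * (n : ℝ))) := by
  have : NeZero K := ⟨by omega⟩
  have : NeZero n := ⟨by omega⟩
  have hvar := group_variance_eq_min_add u c hc
  simp only [Fintype.card_fin] at hvar
  have hrow : 0 ≤ u * ∑ i, (∑ k, c i k - 1 / (n : ℝ)) ^ 2 := by positivity
  have hall : 0 ≤ ∑ i, ∑ k, (c i k - 1 / ((K : ℝ) * (n : ℝ))) ^ 2 := by positivity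
  refine ⟨by linarith, fun h i k => ?_, fun h => ?_⟩
  · have hzero : ∑ i, ∑ k, (c i k - 1 / ((K : ℝ) * (n : ℝ))) ^ 2 = 0 := by linarith
    rw [← Fintype.sum_prod_type' (fun i k => (c i k - 1 / ((K : ℝ) * (n : ℝ))) ^ 2),
      Finset.sum_eq_zero_iff_of_nonneg (fun _ _ => sq_nonneg _)] at hzero
    exact sub_eq_zero.mp (pow_eq_zero_iff two_ne_zero |>.mp (hzero (i, k) (Finset.mem_univ _)))
  · have hKr : (K : ℝ) ≠ 0 := Nat.cast_ne_zero.mpr (NeZero.ne K)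
    have hnr : (n : ℝ) ≠ 0 := Nat.cast_ne_zero.mpr (NeZero.ne n)
    simp only [h, Finset.sum_const, Finset.card_univ, Fintype.card_fin, nsmul_eq_mul]
    field_simp

/-- Deterministic form of the BLUE property of `Ȳ₁ - Ȳ₂` in the two-group RCR model:
the variance of any linear unbiased estimator of `α₀ = μ₁ - μ₂` is at least
`σ₁²(Ku+1)/(Kn₁) + σ₂²(Kv+1)/(Kn₂)`, with equality iff all coefficients are uniform. -/
theorem two_group_RCR_blue_optimality
    (K n₁ n₂ : ℕ) (hK : 1 ≤ K) (hn₁ : 1 ≤ n₁) (hn₂ : 1 ≤ n₂)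
    (σ₁ σ₂ u v : ℝ) (hσ₁ : 0 < σ₁) (hσ₂ : 0 < σ₂) (hu : 0 < u) (hv : 0 < v)
    (c : Fin n₁ → Fin K → ℝ) (d : Fin n₂ → Fin K → ℝ)
    (hc : ∑ i, ∑ k, c i k = 1) (hd : ∑ j, ∑ k, d j k = 1) :
    σ₁ ^ 2 * (u * ∑ i, (∑ k, c i k) ^ 2 + ∑ i, ∑ k, (c i k) ^ 2)
        + σ₂ ^ 2 * (v * ∑ j, (∑ k, d j k) ^ 2 + ∑ j, ∑ k, (d j k) ^ 2)
      ≥ σ₁ ^ 2 * ((K : ℝ) * u + 1) / ((K : ℝ) * (n₁ : ℝ))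
        + σ₂ ^ 2 * ((K : ℝ) * v + 1) / ((K : ℝ) * (n₂ : ℝ))
    ∧ (σ₁ ^ 2 * (u * ∑ i, (∑ k, c i k) ^ 2 + ∑ i, ∑ k, (c i k) ^ 2)
          + σ₂ ^ 2 * (v * ∑ j, (∑ k, d j k) ^ 2 + ∑ j, ∑ k, (d j k) ^ 2)
        = σ₁ ^ 2 * ((K : ℝ) * u + 1) / ((K : ℝ) * (n₁ : ℝ))
          + σ₂ ^ 2 * ((K : ℝ) * v + 1) / ((K : ℝ) * (n₂ : ℝ))
      ↔ (∀ i k, c i k = 1 / ((K : ℝ) * (n₁ : ℝ)))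
          ∧ (∀ j k, d j k = 1 / ((K : ℝ) * (n₂ : ℝ)))) := by
  obtain ⟨hcmin, hceq⟩ := group_variance_min hK hn₁ hu c hc
  obtain ⟨hdmin, hdeq⟩ := group_variance_min hK hn₂ hv d hd
  have hs₁ : 0 < σ₁ ^ 2 := by positivity
  have hs₂ : 0 < σ₂ ^ 2 := by positivity
  have hcle := mul_le_mul_of_nonneg_left hcmin hs₁.le
  have hdle := mul_le_mul_of_nonneg_left hdmin hs₂.le
  rw [mul_div_assoc, mul_div_assoc]
  refine ⟨add_le_add hcle hdle, ?_⟩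
  rw [eq_comm, add_eq_add_iff_eq_and_eq hcle hdle, mul_right_inj' hs₁.ne',
    mul_right_inj' hs₂.ne', hceq, hdeq]
end

section
/- (Deterministic form of the BLUP property for an individual in group 1.) Let K, n₁, n₂ ≥ 1 be integers, σ₁, σ₂ > 0, u, v > 0 reals, and fix i with 1 ≤ i ≤ n₁. For all real coefficients c_{jk} (1 ≤ j ≤ n₁, 1 ≤ k ≤ K) and d_{jk} (1 ≤ j ≤ n₂, 1 ≤ k ≤ K) with Σ_{j,k} c_{jk} = 1 and Σ_{j,k} d_{jk} = −1, one has σ₁²( u·Σ_{j≤n₁} ((Σ_k c_{jk}) − δ_{ji})² + Σ_{j,k} c_{jk}² ) + σ₂²( v + v·Σ_{j≤n₂} (Σ_k d_{jk})² + Σ_{j,k} d_{jk}² ) ≥ σ₁²/(K(Ku+1)n₁) + σ₁²u/(Ku+1) + σ₂²(Kv+1)/(Kn₂) + σ₂²v, where δ_{ji} is the Kronecker delta. -/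
/-- The square of a sum over a nonempty finite type, divided by the number of terms, is at most
the sum of the squares. -/
theorem sq_sum_div_card_le_sum_sq {ι : Type*} [Fintype ι] [Nonempty ι] (f : ι → ℝ) :
    (∑ i, f i) ^ 2 / Fintype.card ι ≤ ∑ i, f i ^ 2 := by
  rw [div_le_iff₀' (by exact_mod_cast Fintype.card_pos)]
  exact sq_sum_le_card_mul_sum_sq

/-- The sum of the squared row sums, divided by the row length, is at most the sum of the
squared entries. -/
theorem sum_sq_rowSum_div_card_le {ι κ : Type*} [Fintype ι] [Fintype κ] [Nonempty κ]
    (f : ι → κ → ℝ) :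
    (∑ j, (∑ k, f j k) ^ 2) / Fintype.card κ ≤ ∑ j, ∑ k, f j k ^ 2 := by
  rw [Finset.sum_div]
  exact Finset.sum_le_sum fun j _ => sq_sum_div_card_le_sum_sq (f j)

/-- Shifting one coordinate of a vector with coordinate sum `1` by `a` and applying the
Cauchy–Schwarz inequality. -/
theorem sq_one_sub_div_card_le_sum_sq_sub {ι : Type*} [Fintype ι] [DecidableEq ι]
    (s : ι → ℝ) (hs : ∑ j, s j = 1) (i : ι) (a : ℝ) :
    (1 - a) ^ 2 / Fintype.card ι ≤ ∑ j, s j ^ 2 - 2 * a * s i + a ^ 2 := by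
  have : Nonempty ι := ⟨i⟩
  have hsum : ∑ j, (s j - if j = i then a else 0) = 1 - a := by
    simp [Finset.sum_sub_distrib, hs]
  have hsq : ∑ j, (s j - if j = i then a else 0) ^ 2 = ∑ j, s j ^ 2 - 2 * a * s i + a ^ 2 := by
    simp [sub_sq, Finset.sum_add_distrib, Finset.sum_sub_distrib, ite_pow]
    ring
  simpa only [hsum, hsq] using
    sq_sum_div_card_le_sum_sq fun j => s j - if j = i then a else 0

/-- Lower bound for the contribution of the predicted individual's own group. -/
theorem le_mse_own_group {ι κ : Type*} [Fintype ι] [DecidableEq ι] [Fintype κ] [Nonempty κ]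
    {u : ℝ} (hu : 0 < u) (i : ι) (c : ι → κ → ℝ) (hc : ∑ j, ∑ k, c j k = 1) :
    1 / ((Fintype.card κ : ℝ) * (Fintype.card κ * u + 1) * Fintype.card ι)
        + u / (Fintype.card κ * u + 1)
      ≤ u * ∑ j, ((∑ k, c j k) - if j = i then (1 : ℝ) else 0) ^ 2 + ∑ j, ∑ k, c j k ^ 2 := by
  have : Nonempty ι := ⟨i⟩
  have hrow := sum_sq_rowSum_div_card_le c
  have hK : (0 : ℝ) < Fintype.card κ := by exact_mod_cast Fintype.card_pos
  have hn : (0 : ℝ) < Fintype.card ι := by exact_mod_cast Fintype.card_pos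
  generalize (Fintype.card κ : ℝ) = K at *
  have hKu : 0 < K * u + 1 := by positivity
  have hshift := sq_one_sub_div_card_le_sum_sq_sub (fun j => ∑ k, c j k) hc i (K * u / (K * u + 1))
  have hsq : ∑ j, ((∑ k, c j k) - if j = i then (1 : ℝ) else 0) ^ 2
      = ∑ j, (∑ k, c j k) ^ 2 - 2 * ∑ k, c i k + 1 := by
    simp [sub_sq, Finset.sum_add_distrib, Finset.sum_sub_distrib, ite_pow]
  rw [hsq]
  generalize (Fintype.card ι : ℝ) = n at *
  generalize ∑ j, (∑ k, c j k) ^ 2 = S at *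
  generalize ∑ k, c i k = t at *
  have hscaled := mul_le_mul_of_nonneg_left hshift (div_pos hKu hK).le
  have hleft : (K * u + 1) / K * ((1 - K * u / (K * u + 1)) ^ 2 / n)
      = 1 / (K * (K * u + 1) * n) := by
    field_simp
    ring
  have hright : (K * u + 1) / K * (S - 2 * (K * u / (K * u + 1)) * t + (K * u / (K * u + 1)) ^ 2)
      = u * (S - 2 * t + 1) + S / K - u / (K * u + 1) := by
    field_simp
    ring
  linarith

/-- Lower bound for the contribution of the other group. -/
theorem le_mse_other_group {ι κ : Type*} [Fintype ι] [Nonempty ι] [Fintype κ] [Nonempty κ]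
    {v : ℝ} (hv : 0 < v) (d : ι → κ → ℝ) (hd : ∑ j, ∑ k, d j k = -1) :
    (Fintype.card κ * v + 1) / ((Fintype.card κ : ℝ) * Fintype.card ι)
      ≤ v * ∑ j, (∑ k, d j k) ^ 2 + ∑ j, ∑ k, d j k ^ 2 := by
  have hrow := sum_sq_rowSum_div_card_le d
  have hcol := sq_sum_div_card_le_sum_sq fun j => ∑ k, d j k
  have hK : (0 : ℝ) < Fintype.card κ := by exact_mod_cast Fintype.card_pos
  have hn : (0 : ℝ) < Fintype.card ι := by exact_mod_cast Fintype.card_pos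
  rw [hd] at hcol
  calc (Fintype.card κ * v + 1) / ((Fintype.card κ : ℝ) * Fintype.card ι)
      = (v + 1 / Fintype.card κ) * ((-1) ^ 2 / Fintype.card ι) := by
        field_simp
    _ ≤ (v + 1 / Fintype.card κ) * ∑ j, (∑ k, d j k) ^ 2 := by gcongr
    _ = v * ∑ j, (∑ k, d j k) ^ 2 + (∑ j, (∑ k, d j k) ^ 2) / Fintype.card κ := by ring
    _ ≤ _ := by gcongr

/-- Deterministic form of the BLUP property for an individual `i` in group 1 of the
two-group RCR model: the mean squared error of any linear unbiased predictor of
`αᵢ = μ_{1i} - μ_{2i}` is at least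
`σ₁²/(K(Ku+1)n₁) + σ₁²u/(Ku+1) + σ₂²(Kv+1)/(Kn₂) + σ₂²v`. -/
theorem two_group_RCR_blup_optimality_group1
    (K n₁ n₂ : ℕ) (hK : 1 ≤ K) (hn₁ : 1 ≤ n₁) (hn₂ : 1 ≤ n₂)
    (σ₁ σ₂ u v : ℝ) (hσ₁ : 0 < σ₁) (hσ₂ : 0 < σ₂) (hu : 0 < u) (hv : 0 < v)
    (i : Fin n₁)
    (c : Fin n₁ → Fin K → ℝ) (d : Fin n₂ → Fin K → ℝ)
    (hc : ∑ j, ∑ k, c j k = 1) (hd : ∑ j, ∑ k, d j k = -1) :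
    σ₁ ^ 2 * (u * ∑ j, ((∑ k, c j k) - if j = i then (1 : ℝ) else 0) ^ 2
          + ∑ j, ∑ k, (c j k) ^ 2)
        + σ₂ ^ 2 * (v + v * ∑ j, (∑ k, d j k) ^ 2 + ∑ j, ∑ k, (d j k) ^ 2)
      ≥ σ₁ ^ 2 / ((K : ℝ) * ((K : ℝ) * u + 1) * (n₁ : ℝ))
        + σ₁ ^ 2 * u / ((K : ℝ) * u + 1)
        + σ₂ ^ 2 * ((K : ℝ) * v + 1) / ((K : ℝ) * (n₂ : ℝ))
        + σ₂ ^ 2 * v := by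
  have : NeZero K := ⟨by omega⟩
  have : NeZero n₂ := ⟨by omega⟩
  have hown := mul_le_mul_of_nonneg_left (le_mse_own_group hu i c hc) (sq_nonneg σ₁)
  have hother := mul_le_mul_of_nonneg_left (le_mse_other_group hv d hd) (sq_nonneg σ₂)
  simp only [Fintype.card_fin, mul_add, mul_div_assoc', mul_one] at hown hother ⊢
  linarith
end

section
/- (D-criterion for prediction: determinant identity.) Let n₁, n₂ ≥ 1, N = n₁ + n₂, K ≥ 1 be integers and σ₁, σ₂ > 0, u, v > 0 reals. Consider the N×N block matrix M = [[A₁₁, A₁₂],[A₁₂ᵀ, A₂₂]] where A₁₁ = p·1_{n₁}1_{n₁}ᵀ + r·I_{n₁}, A₂₂ = s·1_{n₂}1_{n₂}ᵀ + t·I_{n₂}, A₁₂ = m·1_{n₁}1_{n₂}ᵀ, with p = σ₁²/(K(Ku+1)n₁) + σ₂²(Kv+1)/(Kn₂), r = σ₁²u/(Ku+1) + σ₂²v, s = σ₁²(Ku+1)/(Kn₁) + σ₂²/(K(Kv+1)n₂), t = σ₁²u + σ₂²v/(Kv+1), m = σ₁²/(Kn₁) + σ₂²/(Kn₂). Then det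 M = r^{n₁−1} · t^{n₂−1} · N[(σ₁²n₂ + σ₂²n₁)(σ₁²u + σ₂²v) + σ₁²σ₂²KuvN] / (K n₁ n₂). -/
/-- The MSE block matrix `[[p·J + r·I, m·J],[m·J, s·J + t·I]]` of the prediction errors
in the two-group RCR model, where `J` denotes all-ones blocks. -/
noncomputable def mseBlockMatrix (n₁ n₂ : ℕ) (p r s t m : ℝ) :
    Matrix (Fin n₁ ⊕ Fin n₂) (Fin n₁ ⊕ Fin n₂) ℝ :=
  Matrix.fromBlocks
    (Matrix.of fun i j => p + if i = j then r else 0)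
    (Matrix.of fun _ _ => m)
    (Matrix.of fun _ _ => m)
    (Matrix.of fun i j => s + if i = j then t else 0)

/-- The determinant of a two-by-two block matrix with constant off-diagonal blocks and
diagonal blocks of the form `p·J + r·I`. -/
lemma mseBlockMatrix_det {n₁ n₂ : ℕ} (hn₁ : n₁ ≠ 0) (hn₂ : n₂ ≠ 0) (p s m : ℝ) {r t : ℝ}
    (hr : r ≠ 0) (ht : t ≠ 0) :
    (mseBlockMatrix n₁ n₂ p r s t m).det
      = r ^ (n₁ - 1) * t ^ (n₂ - 1) * ((r + n₁ * p) * (t + n₂ * s) - n₁ * n₂ * m ^ 2) := by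
  let D : Matrix (Fin n₁ ⊕ Fin n₂) (Fin n₁ ⊕ Fin n₂) ℝ :=
    Matrix.diagonal (Sum.elim (fun _ => r) (fun _ => t))
  let X : Matrix (Fin n₁ ⊕ Fin n₂) (Fin 2) ℝ :=
    Matrix.of (Sum.elim (fun _ => ![r⁻¹, 0]) (fun _ => ![0, t⁻¹]))
  let Y : Matrix (Fin 2) (Fin n₁ ⊕ Fin n₂) ℝ :=
    Matrix.of ![Sum.elim (fun _ => p) (fun _ => m), Sum.elim (fun _ => m) (fun _ => s)]
  have hM : mseBlockMatrix n₁ n₂ p r s t m = D * (1 + X * Y) := by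
    ext i j
    rw [Matrix.diagonal_mul]
    rcases i with i | i <;> rcases j with j | j <;>
      simp [mseBlockMatrix, X, Y, Matrix.mul_apply, Matrix.one_apply, mul_add, hr, ht, add_comm]
  have hYX : (1 + Y * X).det
      = (1 + n₁ * (p * r⁻¹)) * (1 + n₂ * (s * t⁻¹)) - n₂ * (m * t⁻¹) * (n₁ * (m * r⁻¹)) := by
    simp [Matrix.det_fin_two, X, Y, Matrix.vecMul, dotProduct]
  rw [hM, Matrix.det_mul, Matrix.det_one_add_mul_comm, hYX, Matrix.det_diagonal]
  obtain ⟨a, rfl⟩ := Nat.exists_eq_succ_of_ne_zero hn₁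
  obtain ⟨b, rfl⟩ := Nat.exists_eq_succ_of_ne_zero hn₂
  simp only [Fintype.prod_sum_type, Sum.elim_inl, Sum.elim_inr, Finset.prod_const,
    Finset.card_univ, Fintype.card_fin, Nat.succ_eq_add_one, Nat.add_sub_cancel, pow_succ]
  field_simp

/-- Determinant identity for the MSE matrix of the vector of predictors in the two-group
RCR model (D-criterion for prediction). -/
theorem mse_matrix_det
    (n₁ n₂ K : ℕ) (hn₁ : 1 ≤ n₁) (hn₂ : 1 ≤ n₂) (hK : 1 ≤ K)
    (σ₁ σ₂ u v : ℝ) (hσ₁ : 0 < σ₁) (hσ₂ : 0 < σ₂) (hu : 0 < u) (hv : 0 < v) :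
    (mseBlockMatrix n₁ n₂
        (σ₁ ^ 2 / ((K : ℝ) * ((K : ℝ) * u + 1) * (n₁ : ℝ))
          + σ₂ ^ 2 * ((K : ℝ) * v + 1) / ((K : ℝ) * (n₂ : ℝ)))
        (σ₁ ^ 2 * u / ((K : ℝ) * u + 1) + σ₂ ^ 2 * v)
        (σ₁ ^ 2 * ((K : ℝ) * u + 1) / ((K : ℝ) * (n₁ : ℝ))
          + σ₂ ^ 2 / ((K : ℝ) * ((K : ℝ) * v + 1) * (n₂ : ℝ)))
        (σ₁ ^ 2 * u + σ₂ ^ 2 * v / ((K : ℝ) * v + 1))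
        (σ₁ ^ 2 / ((K : ℝ) * (n₁ : ℝ)) + σ₂ ^ 2 / ((K : ℝ) * (n₂ : ℝ)))).det
      = (σ₁ ^ 2 * u / ((K : ℝ) * u + 1) + σ₂ ^ 2 * v) ^ (n₁ - 1)
        * (σ₁ ^ 2 * u + σ₂ ^ 2 * v / ((K : ℝ) * v + 1)) ^ (n₂ - 1)
        * (((n₁ : ℝ) + (n₂ : ℝ))
            * ((σ₁ ^ 2 * (n₂ : ℝ) + σ₂ ^ 2 * (n₁ : ℝ)) * (σ₁ ^ 2 * u + σ₂ ^ 2 * v)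
              + σ₁ ^ 2 * σ₂ ^ 2 * (K : ℝ) * u * v * ((n₁ : ℝ) + (n₂ : ℝ)))
          / ((K : ℝ) * (n₁ : ℝ) * (n₂ : ℝ))) := by
  have h₁ : (0 : ℝ) < n₁ := by exact_mod_cast hn₁
  have h₂ : (0 : ℝ) < n₂ := by exact_mod_cast hn₂
  have hK' : (0 : ℝ) < K := by exact_mod_cast hK
  rw [mseBlockMatrix_det (by omega) (by omega) _ _ _ (by positivity) (by positivity)]
  congr 1
  have hKu : (K : ℝ) * u + 1 ≠ 0 := by positivity
  have hKv : (K : ℝ) * v + 1 ≠ 0 := by positivity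
  field_simp
  ring
end

section
/- (D-optimal allocation rate for prediction.) Let a be a nonzero real number. The function f(w) = a·w − log(w(1−w)) on the open interval (0,1) attains a unique global minimum at w* = (a + 2 − √(a² + 4))/(2a). In particular, in the two-group RCR model with σ₁² = σ₂² and u ≠ v, taking a = N·log((Kv+1)/(Ku+1)) (N ≥ 1, K ≥ 1 integers, u, v > 0), the D-optimal allocation rate for the prediction of the individual contrasts is w*_{D,α} = (a + 2 − √(a² + 4))/(2a). -/
/-- The D-criterion for prediction (up to an additive constant), as a function of the
allocation rate `w`: `f(w) = a·w - log(w(1-w))`. -/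
noncomputable def predDCrit (a w : ℝ) : ℝ := a * w - Real.log (w * (1 - w))

/-- The D-optimal allocation rate `w* = (a + 2 - √(a² + 4))/(2a)`. -/
noncomputable def wDOpt (a : ℝ) : ℝ := (a + 2 - Real.sqrt (a ^ 2 + 4)) / (2 * a)

theorem wDOpt_mem_Ioo {a : ℝ} (ha : a ≠ 0) : wDOpt a ∈ Set.Ioo (0 : ℝ) 1 := by
  have hr0 : 0 ≤ √(a ^ 2 + 4) := Real.sqrt_nonneg _
  have hr : √(a ^ 2 + 4) ^ 2 = a ^ 2 + 4 := Real.sq_sqrt (by positivity)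
  unfold wDOpt
  rcases ha.lt_or_gt with h | h
  · constructor
    · apply div_pos_of_neg_of_neg <;> nlinarith
    · rw [div_lt_one_of_neg (by linarith)]
      nlinarith
  · constructor
    · apply div_pos <;> nlinarith
    · rw [div_lt_one (by linarith)]
      nlinarith

/-- The stationarity equation of the criterion at `wDOpt a`, with denominators cleared. -/
theorem wDOpt_stationary {a : ℝ} (ha : a ≠ 0) :
    a * (wDOpt a * (1 - wDOpt a)) = 1 - 2 * wDOpt a := by
  have hr : √(a ^ 2 + 4) ^ 2 = a ^ 2 + 4 := Real.sq_sqrt (by positivity)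
  unfold wDOpt
  field_simp
  linear_combination -hr

theorem predDCrit_lt_of_stationary {a s w : ℝ} (hs : s ∈ Set.Ioo (0 : ℝ) 1)
    (hstat : a * (s * (1 - s)) = 1 - 2 * s) (hw : w ∈ Set.Ioo (0 : ℝ) 1) (hne : w ≠ s) :
    predDCrit a s < predDCrit a w := by
  obtain ⟨hs0, hs1⟩ := hs
  obtain ⟨hw0, hw1⟩ := hw
  have hs1' : 0 < 1 - s := sub_pos.2 hs1
  have hw1' : 0 < 1 - w := sub_pos.2 hw1
  have hlog : Real.log (w / s) < w / s - 1 :=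
    Real.log_lt_sub_one_of_pos (div_pos hw0 hs0) fun h => hne ((div_eq_one_iff_eq hs0.ne').1 h)
  have hlog' : Real.log ((1 - w) / (1 - s)) ≤ (1 - w) / (1 - s) - 1 :=
    Real.log_le_sub_one_of_pos (div_pos hw1' hs1')
  rw [Real.log_div hw0.ne' hs0.ne'] at hlog
  rw [Real.log_div hw1'.ne' hs1'.ne'] at hlog'
  have htangent : (w / s - 1) + ((1 - w) / (1 - s) - 1) = a * (w - s) := by
    field_simp
    linear_combination (s - w) * hstat
  unfold predDCrit
  rw [Real.log_mul hw0.ne' hw1'.ne', Real.log_mul hs0.ne' hs1'.ne']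
  linarith

theorem wDOpt_unique_minimizer {a : ℝ} (ha : a ≠ 0) :
    wDOpt a ∈ Set.Ioo (0 : ℝ) 1
    ∧ ∀ w ∈ Set.Ioo (0 : ℝ) 1, w ≠ wDOpt a → predDCrit a (wDOpt a) < predDCrit a w :=
  ⟨wDOpt_mem_Ioo ha, fun _ hw hne =>
    predDCrit_lt_of_stationary (wDOpt_mem_Ioo ha) (wDOpt_stationary ha) hw hne⟩

/-- For `a ≠ 0`, the function `f(w) = a·w - log(w(1-w))` on `(0,1)` attains a unique global
minimum at `w* = (a + 2 - √(a² + 4))/(2a)`.  In particular, with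
`a = N·log((Kv+1)/(Ku+1))` (`σ₁² = σ₂²`, `u ≠ v`), the D-optimal allocation rate for
prediction is `w*_{D,α} = (a + 2 - √(a² + 4))/(2a)`. -/
theorem predD_criterion_unique_minimizer :
    (∀ a : ℝ, a ≠ 0 →
      wDOpt a ∈ Set.Ioo (0 : ℝ) 1
      ∧ ∀ w ∈ Set.Ioo (0 : ℝ) 1, w ≠ wDOpt a → predDCrit a (wDOpt a) < predDCrit a w)
    ∧ ∀ (N K : ℕ) (u v : ℝ), 1 ≤ N → 1 ≤ K → 0 < u → 0 < v → u ≠ v →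
        wDOpt ((N : ℝ) * Real.log (((K : ℝ) * v + 1) / ((K : ℝ) * u + 1))) ∈ Set.Ioo (0 : ℝ) 1
        ∧ ∀ w ∈ Set.Ioo (0 : ℝ) 1,
            w ≠ wDOpt ((N : ℝ) * Real.log (((K : ℝ) * v + 1) / ((K : ℝ) * u + 1))) →
            predDCrit ((N : ℝ) * Real.log (((K : ℝ) * v + 1) / ((K : ℝ) * u + 1)))
                (wDOpt ((N : ℝ) * Real.log (((K : ℝ) * v + 1) / ((K : ℝ) * u + 1))))
              < predDCrit ((N : ℝ) * Real.log (((K : ℝ) * v + 1) / ((K : ℝ) * u + 1))) w := by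
  refine ⟨fun a ha => wDOpt_unique_minimizer ha, fun N K u v hN hK hu hv huv =>
    wDOpt_unique_minimizer (mul_ne_zero (Nat.cast_ne_zero.2 (by lia)) ?_)⟩
  have hK0 : (0 : ℝ) < K := Nat.cast_pos.2 hK
  have hKu : 0 < (K : ℝ) * u + 1 := by positivity
  have hKv : 0 < (K : ℝ) * v + 1 := by positivity
  refine Real.log_ne_zero_of_pos_of_ne_one (div_pos hKv hKu) fun h => huv ?_
  rw [div_eq_one_iff_eq hKu.ne'] at h
  exact (mul_left_cancel₀ hK0.ne' (add_right_cancel h)).symm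
end

section
/- Let a ≠ 0 be real and set w*(a) = (a + 2 − √(a² + 4))/(2a). Then w*(a) ∈ (0,1); moreover w*(a) > 1/2 if and only if a < 0, and w*(a) < 1/2 if and only if a > 0. Consequently, for integers N ≥ 1, K ≥ 1 and reals u, v > 0 with u ≠ v and a = N·log((Kv+1)/(Ku+1)), the D-optimal allocation rate w*_{D,α} = w*(a) satisfies w*_{D,α} > 1/2 if u > v and w*_{D,α} < 1/2 if u < v. -/
/-- A form of `wDOpt` without cancellation, from which its position relative to `1/2` is visible. -/
theorem wDOpt_eq_half_sub {a : ℝ} (ha : a ≠ 0) :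
    wDOpt a = 1 / 2 - a / (2 * (Real.sqrt (a ^ 2 + 4) + 2)) := by
  have hs : Real.sqrt (a ^ 2 + 4) ^ 2 = a ^ 2 + 4 := Real.sq_sqrt (by positivity)
  have hpos : Real.sqrt (a ^ 2 + 4) + 2 ≠ 0 := by positivity
  unfold wDOpt
  field_simp
  linear_combination -hs

theorem half_lt_wDOpt_iff {a : ℝ} (ha : a ≠ 0) : 1 / 2 < wDOpt a ↔ a < 0 := by
  have hpos : 0 < 2 * (Real.sqrt (a ^ 2 + 4) + 2) := by positivity
  rw [wDOpt_eq_half_sub ha, lt_sub_comm, sub_self, div_lt_iff₀ hpos, zero_mul]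

theorem wDOpt_lt_half_iff {a : ℝ} (ha : a ≠ 0) : wDOpt a < 1 / 2 ↔ 0 < a := by
  have hpos : 0 < 2 * (Real.sqrt (a ^ 2 + 4) + 2) := by positivity
  rw [wDOpt_eq_half_sub ha, sub_lt_self_iff, lt_div_iff₀ hpos, zero_mul]

/-- For `a ≠ 0` one has `w*(a) ∈ (0,1)`, `w*(a) > 1/2 ↔ a < 0` and `w*(a) < 1/2 ↔ a > 0`.
Consequently, with `a = N·log((Kv+1)/(Ku+1))` and `u ≠ v`, the D-optimal allocation rate
satisfies `w*_{D,α} > 1/2` if `u > v` and `w*_{D,α} < 1/2` if `u < v`. -/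
theorem wDOpt_vs_half :
    (∀ a : ℝ, a ≠ 0 →
      wDOpt a ∈ Set.Ioo (0 : ℝ) 1 ∧ (wDOpt a > 1 / 2 ↔ a < 0) ∧ (wDOpt a < 1 / 2 ↔ a > 0))
    ∧ ∀ (N K : ℕ) (u v : ℝ), 1 ≤ N → 1 ≤ K → 0 < u → 0 < v → u ≠ v →
        (u > v → wDOpt ((N : ℝ) * Real.log (((K : ℝ) * v + 1) / ((K : ℝ) * u + 1))) > 1 / 2)
        ∧ (u < v →
            wDOpt ((N : ℝ) * Real.log (((K : ℝ) * v + 1) / ((K : ℝ) * u + 1))) < 1 / 2) := by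
  refine ⟨fun a ha => ⟨wDOpt_mem_Ioo ha, half_lt_wDOpt_iff ha, wDOpt_lt_half_iff ha⟩, ?_⟩
  intro N K u v hN hK hu hv _
  have hN' : (0 : ℝ) < N := by exact_mod_cast hN
  have hK' : (0 : ℝ) < K := by exact_mod_cast hK
  have hden : 0 < (K : ℝ) * u + 1 := by positivity
  constructor
  · intro huv
    have hlog : Real.log (((K : ℝ) * v + 1) / ((K : ℝ) * u + 1)) < 0 :=
      Real.log_neg (by positivity) ((div_lt_one hden).mpr (by gcongr))
    have hneg := mul_neg_of_pos_of_neg hN' hlog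
    exact (half_lt_wDOpt_iff hneg.ne).mpr hneg
  · intro huv
    have hlog : 0 < Real.log (((K : ℝ) * v + 1) / ((K : ℝ) * u + 1)) :=
      Real.log_pos ((one_lt_div hden).mpr (by gcongr))
    have hpos := mul_pos hN' hlog
    exact (wDOpt_lt_half_iff hpos.ne').mpr hpos
end

section
/- The function g: ℝ → ℝ defined by g(a) = (a + 2 − √(a² + 4))/(2a) for a ≠ 0 and g(0) = 1/2 is strictly decreasing on ℝ. Consequently, for fixed integers N ≥ 1, K ≥ 1, the D-optimal allocation rate w*_{D,α} = g(N·log((Kv+1)/(Ku+1))) is strictly increasing in u > 0 and strictly decreasing in v > 0. -/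
/-- The D-optimal allocation rate as a function of `a`, with `g(0) = 1/2`. -/
noncomputable def gDOpt (a : ℝ) : ℝ :=
  if a = 0 then 1 / 2 else (a + 2 - Real.sqrt (a ^ 2 + 4)) / (2 * a)

/-- The rationalized form of `gDOpt`, which also covers `a = 0`. -/
theorem gDOpt_eq_two_div (a : ℝ) : gDOpt a = 2 / (a + 2 + Real.sqrt (a ^ 2 + 4)) := by
  have hs : Real.sqrt (a ^ 2 + 4) ^ 2 = a ^ 2 + 4 := Real.sq_sqrt (by positivity)
  have hlt : -a < Real.sqrt (a ^ 2 + 4) := Real.lt_sqrt_of_sq_lt (by nlinarith)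
  have hpos : a + 2 + Real.sqrt (a ^ 2 + 4) ≠ 0 := by linarith
  unfold gDOpt
  split_ifs with ha
  · have h4 : Real.sqrt (0 ^ 2 + 4) = 2 := by
      rw [Real.sqrt_eq_iff_mul_self_eq] <;> norm_num
    rw [ha, h4]
    norm_num
  · rw [div_eq_div_iff (by simpa using ha) hpos]
    linear_combination -hs

theorem strictMono_add_sqrt_sq_add_four :
    StrictMono fun a : ℝ => a + Real.sqrt (a ^ 2 + 4) := by
  intro a b hab
  have hs : Real.sqrt (b ^ 2 + 4) ^ 2 = b ^ 2 + 4 := Real.sq_sqrt (by positivity)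
  have hlt : -b < Real.sqrt (b ^ 2 + 4) := Real.lt_sqrt_of_sq_lt (by nlinarith)
  have h0 : 0 ≤ Real.sqrt (b ^ 2 + 4) := Real.sqrt_nonneg _
  have key : Real.sqrt (a ^ 2 + 4) < b - a + Real.sqrt (b ^ 2 + 4) := by
    rw [Real.sqrt_lt' (by linarith)]
    nlinarith [mul_pos (sub_pos.2 hab) (neg_lt_iff_pos_add.1 hlt)]
  show a + Real.sqrt (a ^ 2 + 4) < b + Real.sqrt (b ^ 2 + 4)
  linarith

theorem strictAnti_gDOpt : StrictAnti gDOpt := by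
  intro a b hab
  have hlt : -a < Real.sqrt (a ^ 2 + 4) := Real.lt_sqrt_of_sq_lt (by nlinarith)
  have hmono : a + Real.sqrt (a ^ 2 + 4) < b + Real.sqrt (b ^ 2 + 4) :=
    strictMono_add_sqrt_sq_add_four hab
  rw [gDOpt_eq_two_div, gDOpt_eq_two_div]
  exact div_lt_div_of_pos_left two_pos (by linarith) (by linarith)

/-- The function `g` is strictly decreasing on `ℝ`.  Consequently, the D-optimal
allocation rate `w*_{D,α} = g(N·log((Kv+1)/(Ku+1)))` is strictly increasing in `u > 0`
and strictly decreasing in `v > 0`. -/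
theorem gDOpt_strictAnti :
    StrictAnti gDOpt
    ∧ (∀ (N K : ℕ), 1 ≤ N → 1 ≤ K → ∀ v : ℝ, 0 < v →
        StrictMonoOn
          (fun u => gDOpt ((N : ℝ) * Real.log (((K : ℝ) * v + 1) / ((K : ℝ) * u + 1))))
          (Set.Ioi 0))
    ∧ (∀ (N K : ℕ), 1 ≤ N → 1 ≤ K → ∀ u : ℝ, 0 < u →
        StrictAntiOn
          (fun v => gDOpt ((N : ℝ) * Real.log (((K : ℝ) * v + 1) / ((K : ℝ) * u + 1))))
          (Set.Ioi 0)) := by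
  refine ⟨strictAnti_gDOpt, fun N K hN hK v hv x hx y hy hxy => strictAnti_gDOpt ?_,
    fun N K hN hK u hu x hx y hy hxy => strictAnti_gDOpt ?_⟩
  all_goals
    have hN' : (0 : ℝ) < N := Nat.cast_pos.2 hN
    have hK' : (0 : ℝ) < K := Nat.cast_pos.2 hK
    have hx' : (0 : ℝ) < x := hx
    have hy' : (0 : ℝ) < y := hy
    refine mul_lt_mul_of_pos_left (Real.log_lt_log (by positivity) ?_) hN'
    gcongr
end
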